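/- There exists a shift-invariant ergodic Borel probability measure μ on {0,1}^ℕ such that: (a) for every real α > 1 the α-th order Rényi entropy rate of μ exists and equals 0, i.e. (1/((1−α)·n))·log ∑_{w∈{0,1}^n} μ[w]^α → 0 as n → ∞; and (b) the Shannon entropy rate of μ is strictly positive (indeed exceeds (1/2)·log 2). Consequently, lim_{α→1⁺} H_α(μ) = 0 < H(μ): the Rényi entropy rate of a stationary ergodic process need not converge to its Shannon entropy rate as α → 1. -/

import Mathlib

open MeasureTheory Filter Topology

/-- The left shift on one-sided sequences. -/
def shift {𝒜 : Type} (x : ℕ → 𝒜) : ℕ → 𝒜 := fun n => x (n + 1)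

/-- The measure of the cylinder set determined by a finite word `w`. -/
noncomputable def cylMeas {𝒜 : Type} [MeasurableSpace 𝒜] (μ : Measure (ℕ → 𝒜)) {n : ℕ}
    (w : Fin n → 𝒜) : ℝ :=
  (μ {x : ℕ → 𝒜 | ∀ i : Fin n, x i.val = w i}).toReal

lemma measurable_shift {𝒜 : Type} [MeasurableSpace 𝒜] :
    Measurable (shift : (ℕ → 𝒜) → ℕ → 𝒜) := by
  unfold shift
  fun_prop

lemma shift_iterate {𝒜 : Type} (x : ℕ → 𝒜) (m i : ℕ) : shift^[m] x i = x (i + m) := by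
  induction m generalizing x with
  | zero => rfl
  | succ m ih => rw [Function.iterate_succ_apply, ih, shift, add_assoc]

/-- Bernoulli shifts are ergodic, by Kolmogorov's zero-one law. -/
theorem ergodic_shift_infinitePi {𝒜 : Type} [MeasurableSpace 𝒜] (ρ : Measure 𝒜)
    [IsProbabilityMeasure ρ] : Ergodic shift (Measure.infinitePi fun _ : ℕ => ρ) where
  measurable := measurable_shift
  map_eq := Measure.map_infinitePi_infinitePi_of_inj (P := fun _ : ℕ => ρ)
    (add_left_injective 1)
  aeconst_set := fun s hs hinv => by
    have hind : ProbabilityTheory.iIndepFun (fun (i : ℕ) (ω : ℕ → 𝒜) => ω i)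
        (Measure.infinitePi fun _ : ℕ => ρ) :=
      ProbabilityTheory.iIndepFun_infinitePi (X := fun _ ω => ω) (by fun_prop)
    have htail : MeasurableSet[limsup (fun i : ℕ => MeasurableSpace.comap
        (fun ω : ℕ → 𝒜 => ω i) inferInstance) atTop] s := by
      rw [limsup_eq_iInf_iSup_of_nat', MeasurableSpace.measurableSet_iInf]
      intro n
      have hpre : shift^[n] ⁻¹' s = s := by
        rw [Set.preimage_iterate_eq]
        exact Function.iterate_fixed hinv n
      have hcomap : MeasurableSpace.comap (shift^[n]) MeasurableSpace.pi =
          ⨆ i : ℕ, MeasurableSpace.comap (fun ω : ℕ → 𝒜 => ω (i + n)) inferInstance := by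
        simp only [MeasurableSpace.pi, MeasurableSpace.comap_iSup, MeasurableSpace.comap_comp]
        simp only [Function.comp_def, shift_iterate]
      rw [← hcomap]
      exact ⟨s, hs, hpre⟩
    rw [eventuallyConst_set']
    rcases ProbabilityTheory.measure_zero_or_one_of_measurableSet_limsup_atTop
      (fun i => (measurable_pi_apply i).comap_le) hind htail with h | h
    · exact Or.inl (ae_eq_empty.2 h)
    · exact Or.inr (eventuallyEq_univ.2 (mem_ae_iff_prob_eq_one hs |>.2 h))

/-- Subadditivity of Shannon entropy for a finite joint distribution. -/
lemma sum_negMulLog_le_add_marginals {ι κ : Type*} [Fintype ι] [Fintype κ] (a : ι → κ → ℝ)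
    (p : ι → ℝ) (q : κ → ℝ) (ha : ∀ u v, 0 ≤ a u v) (hp : ∀ u, ∑ v, a u v = p u)
    (hq : ∀ v, ∑ u, a u v = q v) (hq1 : ∑ v, q v = 1) :
    ∑ u, ∑ v, Real.negMulLog (a u v) ≤
      ∑ u, Real.negMulLog (p u) + ∑ v, Real.negMulLog (q v) := by
  have hpt : ∀ u v, Real.negMulLog (a u v) ≤
      -(a u v * Real.log (p u)) + -(a u v * Real.log (q v)) + (p u * q v - a u v) := by
    intro u v
    have hpa : a u v ≤ p u := by
      rw [← hp]; exact Finset.single_le_sum (fun v _ => ha u v) (Finset.mem_univ v)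
    have hqa : a u v ≤ q v := by
      rw [← hq]
      exact Finset.single_le_sum (f := fun u => a u v) (fun u _ => ha u v) (Finset.mem_univ u)
    rcases (ha u v).eq_or_lt with h0 | h0
    · rw [← h0] at hpa hqa ⊢
      simpa using mul_nonneg hpa hqa
    · have hp0 := h0.trans_le hpa
      have hq0 := h0.trans_le hqa
      have hlog := Real.log_le_sub_one_of_pos (div_pos (mul_pos hp0 hq0) h0)
      rw [Real.log_div (mul_pos hp0 hq0).ne' h0.ne', Real.log_mul hp0.ne' hq0.ne'] at hlog
      have := mul_le_mul_of_nonneg_left hlog h0.le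
      rw [mul_sub (a u v) (_ / _), mul_div_cancel₀ _ h0.ne'] at this
      rw [Real.negMulLog]
      linarith
  calc ∑ u, ∑ v, Real.negMulLog (a u v)
      ≤ ∑ u, ∑ v, (-(a u v * Real.log (p u)) + -(a u v * Real.log (q v))
          + (p u * q v - a u v)) :=
        Finset.sum_le_sum fun u _ => Finset.sum_le_sum fun v _ => hpt u v
    _ = ∑ u, Real.negMulLog (p u) + ∑ v, Real.negMulLog (q v) := by
        simp only [Finset.sum_add_distrib, Finset.sum_sub_distrib, Finset.sum_neg_distrib,
          ← Finset.mul_sum, hq1, hp, ← Finset.sum_mul, mul_one, sub_self, add_zero]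
        rw [Finset.sum_comm]
        simp only [← Finset.sum_mul, hq, Real.negMulLog, neg_mul, Finset.sum_neg_distrib]

lemma sum_measureReal_inter_preimage_singleton {X κ : Type*} [MeasurableSpace X] [Fintype κ]
    [MeasurableSpace κ] [MeasurableSingletonClass κ] (μ : Measure X) [IsFiniteMeasure μ]
    (A : Set X) {f : X → κ} (hf : Measurable f) :
    ∑ k, μ.real (f ⁻¹' {k} ∩ A) = μ.real A := by
  have h := sum_measureReal_preimage_singleton (μ := μ.restrict A) (f := f) Finset.univ
    (fun k _ => hf (measurableSet_singleton k))
  simpa [measureReal_restrict_apply, hf (measurableSet_singleton _)] using h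

section Words

variable {𝒜 : Type} [MeasurableSpace 𝒜]

lemma cylMeas_eq_measureReal_preimage (μ : Measure (ℕ → 𝒜)) {n : ℕ} (w : Fin n → 𝒜) :
    cylMeas μ w = μ.real ((fun x (i : Fin n) => x i) ⁻¹' {w}) := by
  simp only [cylMeas, Measure.real]
  congr 2
  ext x
  simp [funext_iff]

lemma cylMeas_nonneg (μ : Measure (ℕ → 𝒜)) {n : ℕ} (w : Fin n → 𝒜) : 0 ≤ cylMeas μ w :=
  ENNReal.toReal_nonneg

lemma cylMeas_le_one (μ : Measure (ℕ → 𝒜)) [IsProbabilityMeasure μ] {n : ℕ} (w : Fin n → 𝒜) :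
    cylMeas μ w ≤ 1 :=
  measureReal_le_one

lemma cylMeas_append (μ : Measure (ℕ → 𝒜)) {m n : ℕ} (u : Fin m → 𝒜) (v : Fin n → 𝒜) :
    cylMeas μ (Fin.append u v) = μ.real ((fun x (i : Fin n) => shift^[m] x i) ⁻¹' {v} ∩
      (fun x (i : Fin m) => x i) ⁻¹' {u}) := by
  simp only [cylMeas, Measure.real]
  congr 2
  ext x
  simp [funext_iff, Fin.forall_fin_add, shift_iterate, and_comm, add_comm m]

variable [Fintype 𝒜]

/-- The Shannon entropy of the first `n` letters. -/
noncomputable def blockEntropy (μ : Measure (ℕ → 𝒜)) (n : ℕ) : ℝ :=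
  ∑ w : Fin n → 𝒜, Real.negMulLog (cylMeas μ w)

lemma blockEntropy_nonneg (μ : Measure (ℕ → 𝒜)) [IsProbabilityMeasure μ] (n : ℕ) :
    0 ≤ blockEntropy μ n :=
  Finset.sum_nonneg fun w _ => Real.negMulLog_nonneg (cylMeas_nonneg μ w) (cylMeas_le_one μ w)

variable [MeasurableSingletonClass 𝒜]

lemma sum_cylMeas (μ : Measure (ℕ → 𝒜)) [IsProbabilityMeasure μ] (n : ℕ) :
    ∑ w : Fin n → 𝒜, cylMeas μ w = 1 := by
  have h := sum_measureReal_inter_preimage_singleton μ Set.univ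
    (f := fun x (i : Fin n) => x i) (by fun_prop)
  simpa [cylMeas_eq_measureReal_preimage] using h

lemma blockEntropy_subadditive {μ : Measure (ℕ → 𝒜)} [IsProbabilityMeasure μ]
    (hμ : MeasurePreserving shift μ μ) : Subadditive (blockEntropy μ) := by
  intro m n
  have h := sum_negMulLog_le_add_marginals
    (fun (u : Fin m → 𝒜) (v : Fin n → 𝒜) => cylMeas μ (Fin.append u v))
    (cylMeas μ) (cylMeas μ) (fun _ _ => cylMeas_nonneg _ _) ?_ ?_
    (sum_cylMeas μ n)
  · rw [blockEntropy, ← (Fin.appendEquiv m n).sum_comp, Fintype.sum_prod_type]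
    exact h
  · intro u
    simp only [cylMeas_append, cylMeas_eq_measureReal_preimage μ u]
    refine sum_measureReal_inter_preimage_singleton μ _ ?_
    have := (hμ.iterate m).measurable
    fun_prop
  · intro v
    simp only [cylMeas_append, Set.inter_comm]
    rw [sum_measureReal_inter_preimage_singleton μ _ (by fun_prop),
      cylMeas_eq_measureReal_preimage]
    exact (hμ.iterate m).measureReal_preimage (f := shift^[m])
      (s := (fun x (i : Fin n) => x i) ⁻¹' {v})
      ((show Measurable (fun (x : ℕ → 𝒜) (i : Fin n) => x i) by fun_prop)
        (measurableSet_singleton v)).nullMeasurableSet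

/-- The Shannon entropy rate of a stationary process exists; any linear lower bound on the block
entropies passes to it. -/
lemma exists_tendsto_blockEntropy_div {μ : Measure (ℕ → 𝒜)} [IsProbabilityMeasure μ]
    (hμ : MeasurePreserving shift μ μ) {c : ℝ} (hc : ∀ n : ℕ, c * n ≤ blockEntropy μ n) :
    ∃ h : ℝ, c ≤ h ∧ Tendsto (fun n : ℕ => blockEntropy μ n / n) atTop (𝓝 h) := by
  have hlim := (blockEntropy_subadditive hμ).tendsto_lim
    ⟨0, by rintro _ ⟨n, rfl⟩; exact div_nonneg (blockEntropy_nonneg μ n) n.cast_nonneg⟩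
  refine ⟨_, ge_of_tendsto hlim ?_, hlim⟩
  filter_upwards [eventually_gt_atTop 0] with n hn
  rw [le_div_iff₀ (by exact_mod_cast hn)]
  exact hc n

/-- If the probability of some word of length `n` decays subexponentially, all Rényi entropy rates
of order `α > 1` vanish. -/
lemma tendsto_renyi_of_subexponential {μ : Measure (ℕ → 𝒜)} [IsProbabilityMeasure μ]
    {t : ℕ → ℝ} (ht : ∀ n, 0 < t n) (w : (n : ℕ) → Fin n → 𝒜) (htw : ∀ n, t n ≤ cylMeas μ (w n))
    (hlim : Tendsto (fun n : ℕ => Real.log (t n) / n) atTop (𝓝 0)) {α : ℝ} (hα : 1 < α) :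
    Tendsto (fun n : ℕ => (1 / ((1 - α) * n)) *
      Real.log (∑ w : Fin n → 𝒜, cylMeas μ w ^ α)) atTop (𝓝 0) := by
  have hlow : ∀ n, t n ^ α ≤ ∑ w : Fin n → 𝒜, cylMeas μ w ^ α := fun n =>
    (Real.rpow_le_rpow (ht n).le (htw n) (by linarith)).trans
      (Finset.single_le_sum (f := fun w : Fin n → 𝒜 => cylMeas μ w ^ α)
        (fun w _ => Real.rpow_nonneg (cylMeas_nonneg μ w) α) (Finset.mem_univ (w n)))
  have hupp : ∀ n, ∑ w : Fin n → 𝒜, cylMeas μ w ^ α ≤ 1 := fun n => by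
    rw [← sum_cylMeas μ n]
    exact Finset.sum_le_sum fun w _ => by
      simpa using Real.rpow_le_rpow_of_exponent_ge_of_imp (cylMeas_nonneg μ w)
        (cylMeas_le_one μ w) hα.le (by intros; linarith)
  have hpos : ∀ n, 0 < t n ^ α := fun n => Real.rpow_pos_of_pos (ht n) α
  have hcoef : ∀ n : ℕ, 1 / ((1 - α) * n) ≤ 0 := fun n =>
    one_div_nonpos.2 (mul_nonpos_of_nonpos_of_nonneg (by linarith) n.cast_nonneg)
  refine tendsto_of_tendsto_of_tendsto_of_le_of_le tendsto_const_nhds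
    (h := fun n : ℕ => α / (1 - α) * (Real.log (t n) / n)) ?_ (fun n => ?_) (fun n => ?_)
  · simpa using hlim.const_mul (α / (1 - α))
  · exact mul_nonneg_of_nonpos_of_nonpos (hcoef n)
      (Real.log_nonpos ((hpos n).le.trans (hlow n)) (hupp n))
  · have := mul_le_mul_of_nonpos_left (Real.log_le_log (hpos n) (hlow n)) (hcoef n)
    rw [Real.log_rpow (ht n)] at this
    refine this.trans_eq ?_
    simp only [mul_inv, div_eq_mul_inv]
    ring

end Words

/-- The fraction of words `c` which, erased outside the set marked by `s`, become `w`. -/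
noncomputable def erasureKernel {n : ℕ} (s w : Fin n → Bool) : ℝ :=
  (Finset.univ.filter fun c : Fin n → Bool => (fun i => s i && c i) = w).card / 2 ^ n

lemma erasureKernel_nonneg {n : ℕ} (s w : Fin n → Bool) : 0 ≤ erasureKernel s w := by
  unfold erasureKernel
  positivity

lemma sum_erasureKernel {n : ℕ} (s : Fin n → Bool) : ∑ w, erasureKernel s w = 1 := by
  have h := Finset.card_eq_sum_card_fiberwise (s := Finset.univ) (t := Finset.univ)
    (f := fun (c : Fin n → Bool) i => s i && c i) (by simp)
  simp only [erasureKernel, ← Finset.sum_div]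
  rw [div_eq_one_iff_eq (by positivity), ← Nat.cast_sum, ← h]
  simp

lemma erasureKernel_le {n : ℕ} (s w : Fin n → Bool) :
    erasureKernel s w ≤ Real.exp (-∑ i, if s i then Real.log 2 else 0) := by
  have hset : (Finset.univ.filter fun c : Fin n → Bool => (fun i => s i && c i) = w) =
      Fintype.piFinset fun i => Finset.univ.filter fun b => (s i && b) = w i := by
    ext c
    simp [funext_iff]
  have hpow : (2 : ℝ) ^ n = ∏ _i : Fin n, 2 := by simp
  rw [erasureKernel, hset, Fintype.card_piFinset, Nat.cast_prod, hpow, ← Finset.prod_div_distrib,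
    ← Finset.sum_neg_distrib, Real.exp_sum]
  refine Finset.prod_le_prod (fun _ _ => by positivity) fun i _ => ?_
  have hcard : ∀ a b : Bool, (Finset.univ.filter fun x => (a && x) = b).card ≤
      if a then 1 else 2 := by decide
  have hcard' : ((Finset.univ.filter fun x => (s i && x) = w i).card : ℝ) ≤
      if s i then 1 else 2 := by exact_mod_cast hcard (s i) (w i)
  rw [div_le_iff₀ two_pos]
  refine hcard'.trans_eq ?_
  cases s i <;> simp [Real.exp_neg, Real.exp_log]

/-- A fair-coin word, kept at the positions marked by a random `s` and erased elsewhere, has at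
least `log 2` of entropy per kept position. -/
lemma sum_mul_log_two_le_sum_negMulLog {n : ℕ} (p : (Fin n → Bool) → ℝ) (hp : ∀ s, 0 ≤ p s)
    (hp1 : ∑ s, p s = 1) :
    ∑ s, p s * ∑ i, (if s i then Real.log 2 else 0) ≤
      ∑ w, Real.negMulLog (∑ s, p s * erasureKernel s w) := by
  have hpt : ∀ s w : Fin n → Bool, erasureKernel s w * (∑ i, if s i then Real.log 2 else 0) ≤
      Real.negMulLog (erasureKernel s w) := by
    intro s w
    rcases (erasureKernel_nonneg s w).eq_or_lt with h | h
    · simp [← h]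
    · have := (Real.log_le_iff_le_exp h).2 (erasureKernel_le s w)
      rw [Real.negMulLog, neg_mul, ← mul_neg]
      exact mul_le_mul_of_nonneg_left (by linarith) h.le
  calc ∑ s, p s * ∑ i, (if s i then Real.log 2 else 0)
      = ∑ s, p s * ∑ w, erasureKernel s w * (∑ i, if s i then Real.log 2 else 0) := by
        simp only [← Finset.sum_mul, sum_erasureKernel, one_mul]
    _ ≤ ∑ s, p s * ∑ w, Real.negMulLog (erasureKernel s w) :=
        Finset.sum_le_sum fun s _ => mul_le_mul_of_nonneg_left
          (Finset.sum_le_sum fun w _ => hpt s w) (hp s)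
    _ = ∑ w, ∑ s, p s * Real.negMulLog (erasureKernel s w) := by
        simp only [Finset.mul_sum]
        exact Finset.sum_comm
    _ ≤ ∑ w, Real.negMulLog (∑ s, p s * erasureKernel s w) :=
        Finset.sum_le_sum fun w _ => by
          simpa using Real.concaveOn_negMulLog.le_map_sum (t := Finset.univ) (w := p)
            (p := fun s => erasureKernel s w) (fun s _ => hp s) hp1
            (fun s _ => erasureKernel_nonneg s w)

/-- The probability that an eraser sitting at a given position reaches at least `k` steps back. -/
noncomputable def eraseProb (k : ℕ) : unitInterval :=
  ⟨1 / (4 * ((k + 1) * (k + 2))), by positivity, by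
    rw [div_le_one (by positivity)]
    have : (0 : ℝ) ≤ k := k.cast_nonneg
    nlinarith⟩

lemma coe_eraseProb (k : ℕ) : (eraseProb k : ℝ) = 1 / (4 * ((k + 1) * (k + 2))) := rfl

lemma eraseProb_pos (k : ℕ) : (0 : ℝ) < eraseProb k := by
  rw [coe_eraseProb]
  positivity

lemma eraseProb_antitone : Antitone eraseProb := fun a b hab => by
  have : (a : ℝ) ≤ b := by exact_mod_cast hab
  rw [← Subtype.coe_le_coe, coe_eraseProb, coe_eraseProb]
  gcongr

lemma tsum_eraseProb_le : ∑' k, ENNReal.ofReal (eraseProb k) ≤ ENNReal.ofReal (1 / 4) := by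
  refine ENNReal.tsum_le_of_sum_range_le fun n => ?_
  rw [← ENNReal.ofReal_sum_of_nonneg fun k _ => (eraseProb_pos k).le]
  refine ENNReal.ofReal_le_ofReal ?_
  have h : ∑ k ∈ Finset.range n, (eraseProb k : ℝ) = 1 / 4 - 1 / (4 * (n + 1)) := by
    induction n with
    | zero => simp
    | succ n ih =>
      rw [Finset.sum_range_succ, ih, coe_eraseProb]
      push_cast
      field_simp
      ring
  rw [h]
  exact sub_le_self _ (by positivity)

lemma tendsto_log_eraseProb_div : Tendsto (fun n : ℕ => Real.log (eraseProb n) / n) atTop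
    (𝓝 0) := by
  have hlog : Tendsto (fun n : ℕ => Real.log (2 * n + 4) / n) atTop (𝓝 0) := by
    have h := (Real.tendsto_pow_log_div_mul_add_atTop (1 / 2) (-2) 1 (by norm_num)).comp
      ((tendsto_natCast_atTop_atTop.const_mul_atTop (two_pos (α := ℝ))).atTop_add
        (tendsto_const_nhds (x := (4 : ℝ))))
    refine h.congr fun n => ?_
    simp only [Function.comp_apply, pow_one]
    congr 1
    ring
  refine tendsto_of_tendsto_of_tendsto_of_le_of_le
    (g := fun n : ℕ => -2 * (Real.log (2 * n + 4) / n)) (by simpa using hlog.const_mul (-2))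
    tendsto_const_nhds (fun n => ?_) fun n => ?_
  · have h1 : (eraseProb n : ℝ) ≥ ((2 * n + 4 : ℝ) ^ 2)⁻¹ := by
      rw [coe_eraseProb, one_div]
      gcongr
      nlinarith [(n.cast_nonneg : (0 : ℝ) ≤ n)]
    have h2 := Real.log_le_log (by positivity) h1
    rw [Real.log_inv, Real.log_pow] at h2
    simp only [← mul_div_assoc]
    refine div_le_div_of_nonneg_right ?_ n.cast_nonneg
    push_cast at h2
    linarith
  · exact div_nonpos_of_nonpos_of_nonneg
      (Real.log_nonpos (eraseProb_pos n).le (eraseProb n).2.2) n.cast_nonneg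

/-- The fair coin. -/
noncomputable def fairCoin : Measure Bool :=
  (2⁻¹ : ENNReal) • (Measure.dirac true + Measure.dirac false)

instance : IsProbabilityMeasure fairCoin :=
  ⟨by simp [fairCoin, ENNReal.inv_two_add_inv_two]⟩

lemma measurePreserving_xor_fairCoin (b : Bool) : MeasurePreserving (b ^^ ·) fairCoin fairCoin := by
  refine ⟨measurable_from_top, ?_⟩
  rw [fairCoin, Measure.map_smul, Measure.map_add _ _ measurable_from_top,
    Measure.map_dirac, Measure.map_dirac]
  cases b
  · simp
  · simp [add_comm]

/-- The i.i.d. driving noise: fair bits together with uniform marks governing the erasures. -/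
noncomputable def noise : Measure (ℕ → Bool × unitInterval) :=
  Measure.infinitePi fun _ => fairCoin.prod volume

instance : IsProbabilityMeasure noise := by
  unfold noise
  infer_instance

/-- Position `n` is kept if no later position `n + k` (including `n` itself) erases it. -/
noncomputable def kept (ω : ℕ → Bool × unitInterval) (n : ℕ) : Bool :=
  open Classical in decide (∀ k, eraseProb k ≤ (ω (n + k)).2)

/-- The fair bits, replaced by `false` at erased positions. -/
noncomputable def erasedBits (ω : ℕ → Bool × unitInterval) : ℕ → Bool :=
  fun n => kept ω n && (ω n).1

lemma measurable_kept (n : ℕ) : Measurable fun ω => kept ω n := by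
  refine measurable_to_bool ?_
  have : (fun ω => kept ω n) ⁻¹' {true} = ⋂ k, {ω | eraseProb k ≤ (ω (n + k)).2} := by
    ext ω
    simp [kept]
  rw [this]
  exact MeasurableSet.iInter fun k => measurableSet_le measurable_const (by fun_prop)

lemma measurable_erasedBits : Measurable erasedBits := by
  refine measurable_pi_lambda _ fun n => ?_
  have h : Measurable fun p : Bool × Bool => p.1 && p.2 := measurable_of_finite _
  exact h.comp ((measurable_kept n).prodMk (by fun_prop))

lemma noise_mark_lt (j : ℕ) (a : unitInterval) : noise {ω | (ω j).2 < a} = ENNReal.ofReal a := by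
  have h : MeasurePreserving (fun ω => (ω j).2) noise volume :=
    measurePreserving_snd.comp (measurePreserving_eval_infinitePi
      (fun _ : ℕ => fairCoin.prod (volume : Measure unitInterval)) j)
  rw [← unitInterval.volume_Iio, ← h.measure_preimage measurableSet_Iio.nullMeasurableSet]
  rfl

lemma three_quarters_le_noise_kept (n : ℕ) :
    3 / 4 ≤ noise.real ((fun ω => kept ω n) ⁻¹' {true}) := by
  have hms : MeasurableSet ((fun ω => kept ω n) ⁻¹' {true}) :=
    measurable_kept n (measurableSet_singleton _)
  have hle : noise ((fun ω => kept ω n) ⁻¹' {true})ᶜ ≤ ENNReal.ofReal (1 / 4) := by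
    have hU : ((fun ω => kept ω n) ⁻¹' {true})ᶜ = ⋃ k, {ω | (ω (n + k)).2 < eraseProb k} := by
      ext ω
      simp [kept]
    rw [hU]
    refine (measure_iUnion_le _).trans (le_trans (le_of_eq ?_) tsum_eraseProb_le)
    simp only [noise_mark_lt]
  have hreal : noise.real ((fun ω => kept ω n) ⁻¹' {true})ᶜ ≤ 1 / 4 :=
    ENNReal.toReal_le_of_le_ofReal (by norm_num) hle
  rw [probReal_compl_eq_one_sub hms] at hreal
  linarith

/-- Flipping the fair bits at prescribed positions preserves the noise. -/
lemma measurePreserving_flip (c : ℕ → Bool) :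
    MeasurePreserving (fun ω i => (c i ^^ (ω i).1, (ω i).2)) noise noise := by
  have h i := (measurePreserving_xor_fairCoin (c i)).prod
    (MeasurePreserving.id (volume : Measure unitInterval))
  refine ⟨by
    refine measurable_pi_lambda _ fun i => ?_
    exact (h i).measurable.comp (measurable_pi_apply i), ?_⟩
  have := Measure.infinitePi_map_pi (fun _ : ℕ => fairCoin.prod (volume : Measure unitInterval))
    (fun i => (h i).measurable)
  simp only [(h _).map_eq] at this
  exact this

/-- The pair formed by the first `n` keep marks and the first `n` fair bits. -/
noncomputable def marksAndBits (n : ℕ) (ω : ℕ → Bool × unitInterval) :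
    (Fin n → Bool) × (Fin n → Bool) :=
  (fun i => kept ω i, fun i => (ω i).1)

lemma measurable_marksAndBits (n : ℕ) : Measurable (marksAndBits n) :=
  (measurable_pi_lambda (fun ω (i : Fin n) => kept ω i) fun i => measurable_kept i).prodMk
    (by fun_prop)

/-- The fair bits are uniform given the keep marks. -/
lemma noise_marksAndBits {n : ℕ} (s c : Fin n → Bool) :
    noise.real (marksAndBits n ⁻¹' {(s, c)}) =
      noise.real ((fun ω (i : Fin n) => kept ω i) ⁻¹' {s}) / 2 ^ n := by
  have hflip : ∀ c, noise.real (marksAndBits n ⁻¹' {(s, c)}) =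
      noise.real (marksAndBits n ⁻¹' {(s, fun _ => false)}) := by
    intro c
    rw [← (measurePreserving_flip fun i =>
      if h : i < n then c ⟨i, h⟩ else false).measureReal_preimage
      (s := marksAndBits n ⁻¹' {(s, fun _ => false)})
      (measurable_marksAndBits n (measurableSet_singleton _)).nullMeasurableSet]
    congr 1
    ext ω
    simp only [marksAndBits, kept, funext_iff, Set.mem_preimage, Set.mem_singleton_iff,
      Prod.mk.injEq, Fin.is_lt, dite_true, Fin.eta, bne_eq_false_iff_eq]
    exact and_congr_right fun _ => forall_congr' fun _ => eq_comm
  have hsum := sum_measureReal_inter_preimage_singleton noise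
    ((fun ω (i : Fin n) => kept ω i) ⁻¹' {s})
    (f := fun ω (i : Fin n) => (ω i).1) (by fun_prop)
  have hint : ∀ c : Fin n → Bool,
      (fun (ω : ℕ → Bool × unitInterval) (i : Fin n) => (ω i).1) ⁻¹' {c} ∩
      (fun ω (i : Fin n) => kept ω i) ⁻¹' {s} = marksAndBits n ⁻¹' {(s, c)} := by
    intro c
    ext ω
    simp [marksAndBits, and_comm]
  simp only [hint, hflip, Finset.sum_const, Finset.card_univ, Fintype.card_pi, Fintype.card_bool,
    Finset.prod_const, Fintype.card_fin, nsmul_eq_mul] at hsum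
  rw [hflip, ← hsum]
  push_cast
  field_simp

/-- The law of the erased bits. -/
noncomputable def erasedLaw : Measure (ℕ → Bool) := noise.map erasedBits

instance : IsProbabilityMeasure erasedLaw :=
  Measure.isProbabilityMeasure_map measurable_erasedBits.aemeasurable

lemma ergodic_erasedLaw : Ergodic shift erasedLaw := by
  refine MeasurePreserving.ergodic_of_ergodic_semiconj
    (measurable_erasedBits.measurePreserving noise) (ergodic_shift_infinitePi _)
    measurable_shift fun ω => ?_
  ext n
  have h : kept (shift ω) n = kept ω (n + 1) :=
    decide_eq_decide.2 (forall_congr' fun k => by rw [shift, add_right_comm])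
  simp [erasedBits, shift, h]

lemma cylMeas_erasedLaw {n : ℕ} (w : Fin n → Bool) :
    cylMeas erasedLaw w = noise.real {ω | ∀ i : Fin n, erasedBits ω i = w i} := by
  rw [cylMeas_eq_measureReal_preimage, erasedLaw, map_measureReal_apply measurable_erasedBits
    ((show Measurable (fun (x : ℕ → Bool) (i : Fin n) => x i) by fun_prop)
      (measurableSet_singleton w))]
  congr 1
  ext ω
  simp [funext_iff]

lemma eraseProb_le_cylMeas_false (n : ℕ) :
    (eraseProb n : ℝ) ≤ cylMeas erasedLaw (fun _ : Fin n => false) := by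
  have h : noise.real {ω | (ω n).2 < eraseProb n} = eraseProb n := by
    rw [Measure.real, noise_mark_lt, ENNReal.toReal_ofReal (eraseProb_pos n).le]
  rw [cylMeas_erasedLaw, ← h]
  refine measureReal_mono fun ω hω i => ?_
  have hin : (i : ℕ) + (n - i) = n := by omega
  have : kept ω i = false := by
    simp only [kept, decide_eq_false_iff_not, not_forall, not_le]
    exact ⟨n - i, by rw [hin]; exact hω.trans_le (eraseProb_antitone (Nat.sub_le n i))⟩
  simp [erasedBits, this]

lemma cylMeas_erasedLaw_eq_sum {n : ℕ} (w : Fin n → Bool) :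
    cylMeas erasedLaw w =
      ∑ s, noise.real ((fun ω (i : Fin n) => kept ω i) ⁻¹' {s}) * erasureKernel s w := by
  have hpre : {ω | ∀ i : Fin n, erasedBits ω i = w i} = marksAndBits n ⁻¹'
      ↑(Finset.univ.filter fun z : (Fin n → Bool) × (Fin n → Bool) =>
        (fun i => z.1 i && z.2 i) = w) := by
    ext ω
    simp [marksAndBits, erasedBits, funext_iff]
  rw [cylMeas_erasedLaw, hpre, ← sum_measureReal_preimage_singleton _
    fun z _ => measurable_marksAndBits n (measurableSet_singleton z), Finset.sum_filter,
    Fintype.sum_prod_type]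
  refine Finset.sum_congr rfl fun s _ => ?_
  simp only [noise_marksAndBits]
  rw [← Finset.sum_filter, Finset.sum_const, nsmul_eq_mul, erasureKernel]
  ring

lemma le_blockEntropy_erasedLaw (n : ℕ) : 3 / 4 * Real.log 2 * n ≤ blockEntropy erasedLaw n := by
  have hK : Measurable fun ω (i : Fin n) => kept ω i :=
    measurable_pi_lambda _ fun i => measurable_kept i
  have hmean : ∀ i : Fin n, 3 / 4 ≤
      ∑ s, if s i then noise.real ((fun ω (i : Fin n) => kept ω i) ⁻¹' {s}) else 0 := by
    intro i
    refine (three_quarters_le_noise_kept i).trans_eq ?_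
    rw [← Finset.sum_filter, sum_measureReal_preimage_singleton _
      fun s _ => hK (measurableSet_singleton s)]
    congr 1
    ext ω
    simp
  have hp1 : ∑ s, noise.real ((fun ω (i : Fin n) => kept ω i) ⁻¹' {s}) = 1 := by
    simpa using sum_measureReal_inter_preimage_singleton noise Set.univ hK
  calc 3 / 4 * Real.log 2 * n = ∑ _i : Fin n, 3 / 4 * Real.log 2 := by simp [mul_comm]
    _ ≤ ∑ i : Fin n, (∑ s : Fin n → Bool, if s i then
          noise.real ((fun ω (i : Fin n) => kept ω i) ⁻¹' {s}) else 0) * Real.log 2 :=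
        Finset.sum_le_sum fun i _ =>
          mul_le_mul_of_nonneg_right (hmean i) (Real.log_nonneg one_le_two)
    _ = ∑ s, noise.real ((fun ω (i : Fin n) => kept ω i) ⁻¹' {s}) *
          ∑ i, (if s i then Real.log 2 else 0) := by
        simp only [Finset.sum_mul, Finset.mul_sum, ite_mul, mul_ite, zero_mul, mul_zero]
        exact Finset.sum_comm
    _ ≤ blockEntropy erasedLaw n := by
        simp only [blockEntropy, cylMeas_erasedLaw_eq_sum]
        exact sum_mul_log_two_le_sum_negMulLog _ (fun _ => measureReal_nonneg) hp1

/-- Counterexample to the conjecture: there is a stationary ergodic binary process whose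
`α`-th order Rényi entropy rate is `0` for every `α > 1`, while its Shannon entropy rate
exists and exceeds `(1/2)·log 2`. Hence `lim_{α→1⁺} H_α(μ) = 0 < H(μ)`. -/
theorem exists_ergodic_process_renyi_rate_not_continuous_at_one :
    ∃ μ : Measure (ℕ → Bool),
      IsProbabilityMeasure μ ∧ Ergodic shift μ ∧
      (∀ α : ℝ, 1 < α →
        Tendsto
          (fun n : ℕ =>
            (1 / ((1 - α) * n)) * Real.log (∑ w : Fin n → Bool, cylMeas μ w ^ α))
          atTop (nhds 0)) ∧
      ∃ h : ℝ, (1 / 2) * Real.log 2 < h ∧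
        Tendsto
          (fun n : ℕ =>
            (-∑ w : Fin n → Bool, cylMeas μ w * Real.log (cylMeas μ w)) / n)
          atTop (nhds h) := by
  obtain ⟨h, hh, hlim⟩ := exists_tendsto_blockEntropy_div
    ergodic_erasedLaw.toMeasurePreserving le_blockEntropy_erasedLaw
  refine ⟨erasedLaw, inferInstance, ergodic_erasedLaw, fun α hα =>
    tendsto_renyi_of_subexponential eraseProb_pos (fun n _ => false) eraseProb_le_cylMeas_false
      tendsto_log_eraseProb_div hα, h, ?_, ?_⟩
  · linarith [Real.log_pos one_lt_two]
  · simpa only [blockEntropy, Real.negMulLog, neg_mul, Finset.sum_neg_distrib] using hlim
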